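/- arXiv:1804.09682 — 3 statements merged into one kernel-verified Lean document; each statement's English description precedes it below -/
import Mathlib

section
/- Let α, β > 0 and define the memory kernel K(t) = ∑_{k≥1} k^{-(1+αβ)} e^{-t k^{-β}} for t ≥ 0. Then t^α K(t) converges to Γ(α)/β as t → ∞ (where Γ is the Gamma function); in particular K(t) ~ t^{-α} as t → ∞, i.e. the ratio K(t)/t^{-α} tends to a finite positive constant. -/
open Filter

open MeasureTheory Set Real in
/-- Integral over the half line of a step function with steps of length `1 / T`. -/
theorem hasSum_integral_comp_nat_floor (F : ℕ → ℝ) {T : ℝ} (hT : 0 < T)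
    (hF : IntegrableOn (fun x => F ⌊x * T⌋₊) (Ioi 0)) :
    HasSum (fun k => 1 / T * F k) (∫ x in Ioi (0 : ℝ), F ⌊x * T⌋₊) := by
  have hmem : ∀ (k : ℕ) (x : ℝ),
      x ∈ Ico ((k : ℝ) / T) (((k : ℝ) + 1) / T) ↔ 0 ≤ x ∧ ⌊x * T⌋₊ = k := by
    intro k x
    rw [mem_Ico, div_le_iff₀ hT, lt_div_iff₀ hT]
    constructor
    · rintro ⟨h1, h2⟩
      have h0 : 0 ≤ x * T := le_trans (Nat.cast_nonneg k) h1
      exact ⟨nonneg_of_mul_nonneg_left h0 hT, (Nat.floor_eq_iff h0).2 ⟨h1, h2⟩⟩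
    · rintro ⟨h1, h2⟩
      exact (Nat.floor_eq_iff (by positivity)).1 h2
  have hU : (⋃ k : ℕ, Ico ((k : ℝ) / T) (((k : ℝ) + 1) / T)) = Ici 0 := by
    ext x
    simp [hmem, -mem_Ico]
  have key := hasSum_integral_iUnion (f := fun x : ℝ => F ⌊x * T⌋₊) (μ := volume)
    (s := fun k : ℕ => Ico ((k : ℝ) / T) (((k : ℝ) + 1) / T)) (fun _ => measurableSet_Ico)
    (fun i j hij => Set.disjoint_left.2 fun x hi hj =>
      hij (((hmem i x).1 hi).2.symm.trans ((hmem j x).1 hj).2))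
    (by rw [hU]; exact (integrableOn_Ici_iff_integrableOn_Ioi).2 hF)
  rw [hU, integral_Ici_eq_integral_Ioi] at key
  refine (congrArg (HasSum · _) (funext fun k => ?_)).mp key
  rw [setIntegral_congr_fun (g := fun _ => F k) measurableSet_Ico
    (fun x hx => by simp only [((hmem k x).1 hx).2])]
  have : ((k : ℝ) + 1) / T - k / T = 1 / T := by ring
  simp [Measure.real, this, hT.le]

open MeasureTheory Set Real in
/-- Riemann sums over the half line of a continuous function with an antitone integrable
majorant converge to its integral. -/
theorem tendsto_tsum_riemann_Ioi {f g : ℝ → ℝ} (hf : ContinuousOn f (Ioi 0))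
    (hg : AntitoneOn g (Ioi 0)) (hgi : IntegrableOn g (Ioi 0)) (hfg : ∀ x > 0, |f x| ≤ g x) :
    Tendsto (fun T : ℝ => ∑' k : ℕ, 1 / T * f (((k : ℝ) + 1) / T)) atTop
      (nhds (∫ x in Ioi 0, f x)) := by
  have hmeas : ∀ T : ℝ, AEStronglyMeasurable
      (fun x : ℝ => f (((⌊x * T⌋₊ : ℝ) + 1) / T)) (volume.restrict (Ioi 0)) := by
    intro T
    have h1 : Measurable fun k : ℕ => f (((k : ℝ) + 1) / T) := measurable_from_nat
    have h2 : Measurable fun x : ℝ => ⌊x * T⌋₊ := Nat.measurable_floor.comp (by fun_prop)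
    exact (h1.comp h2).aestronglyMeasurable
  have hbound : ∀ T : ℝ, 0 < T → ∀ᵐ x ∂(volume.restrict (Ioi (0 : ℝ))),
      ‖f (((⌊x * T⌋₊ : ℝ) + 1) / T)‖ ≤ g x := by
    intro T hT
    filter_upwards [ae_restrict_mem measurableSet_Ioi] with x hx
    have hy : 0 < ((⌊x * T⌋₊ : ℝ) + 1) / T := by positivity
    exact (hfg _ hy).trans (hg hx hy ((le_div_iff₀ hT).2 (Nat.lt_floor_add_one _).le))
  have hlim : Tendsto (fun T : ℝ => ∫ x in Ioi 0, f (((⌊x * T⌋₊ : ℝ) + 1) / T)) atTop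
      (nhds (∫ x in Ioi 0, f x)) := by
    refine tendsto_integral_filter_of_dominated_convergence g (.of_forall hmeas)
      ((eventually_gt_atTop 0).mono hbound) hgi ?_
    filter_upwards [ae_restrict_mem measurableSet_Ioi] with x hx
    refine (hf.continuousAt (Ioi_mem_nhds hx)).tendsto.comp ?_
    have := (tendsto_nat_floor_mul_div_atTop (le_of_lt hx)).add
      (tendsto_inv_atTop_zero (𝕜 := ℝ))
    rw [add_zero] at this
    refine this.congr fun T => ?_
    ring
  refine hlim.congr' ?_
  filter_upwards [eventually_gt_atTop 0] with T hT
  exact (hasSum_integral_comp_nat_floor (fun k => f (((k : ℝ) + 1) / T)) hT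
    (hgi.mono' (hmeas T) (hbound T hT))).tsum_eq.symm

theorem Real.rpow_le_rpow_self_mul_exp {w p : ℝ} (hw : 0 ≤ w) (hp : 0 < p) :
    w ^ p ≤ p ^ p * exp w := by
  have h1 : w / p ≤ exp (w / p) := by linarith [add_one_le_exp (w / p)]
  have h2 := rpow_le_rpow (by positivity) h1 hp.le
  rwa [← exp_mul, div_mul_cancel₀ _ hp.ne', div_rpow hw hp.le, div_le_iff₀' (by positivity)] at h2

open Real in
theorem rpow_neg_mul_exp_neg_rpow_le {s β x : ℝ} (hs : 0 < s) (hβ : 0 < β) (hx : 0 < x) :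
    x ^ (-s) * exp (-x ^ (-β)) ≤
      2 ^ s * max 1 ((s / β) ^ (s / β)) * (x + 1) ^ (-s) := by
  have hb : x ^ (-s) * exp (-x ^ (-β)) ≤ (s / β) ^ (s / β) := by
    have h := rpow_le_rpow_self_mul_exp (rpow_nonneg hx.le (-β)) (div_pos hs hβ)
    rw [← rpow_mul hx.le, show -β * (s / β) = -s by field_simp] at h
    rw [exp_neg, ← div_eq_mul_inv, div_le_iff₀ (exp_pos _)]
    exact h
  have hb' : x ^ (-s) * exp (-x ^ (-β)) ≤ x ^ (-s) :=
    mul_le_of_le_one_right (by positivity)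
      (exp_le_one_iff.2 (neg_nonpos.2 (rpow_nonneg hx.le _)))
  rw [rpow_neg (by positivity : 0 ≤ x + 1), ← div_eq_mul_inv, le_div_iff₀ (by positivity)]
  have h0 : 0 ≤ x ^ (-s) * exp (-x ^ (-β)) := by positivity
  rcases le_total x 1 with h | h
  · have h2 : (x + 1) ^ s ≤ 2 ^ s := rpow_le_rpow (by positivity) (by linarith) hs.le
    rw [mul_comm]
    exact mul_le_mul h2 (hb.trans (le_max_right _ _)) h0 (by positivity)
  · have h2 : (x + 1) ^ s ≤ 2 ^ s * x ^ s := by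
      rw [← mul_rpow (by norm_num) hx.le]
      exact rpow_le_rpow (by positivity) (by linarith) hs.le
    calc x ^ (-s) * exp (-x ^ (-β)) * (x + 1) ^ s
        ≤ x ^ (-s) * (2 ^ s * x ^ s) := mul_le_mul hb' h2 (by positivity) (by positivity)
      _ = 2 ^ s * (x ^ (-s) * x ^ s) := by ring
      _ = 2 ^ s * 1 := by rw [← rpow_add hx]; simp
      _ ≤ _ := by gcongr; exact le_max_left _ _

open MeasureTheory Set Real in
theorem integral_rpow_neg_mul_exp_neg_rpow {α β : ℝ} (hα : 0 < α) (hβ : 0 < β) :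
    ∫ x in Ioi (0 : ℝ), x ^ (-(1 + α * β)) * exp (-x ^ (-β)) = Gamma α / β := by
  rw [Gamma_eq_integral hα, ← integral_comp_rpow_Ioi (fun u => exp (-u) * u ^ (α - 1)) (neg_ne_zero.2 hβ.ne'),
    ← integral_div]
  refine setIntegral_congr_fun measurableSet_Ioi fun x (hx : 0 < x) => ?_
  have h : x ^ (-(1 + α * β)) = x ^ (-β - 1) * (x ^ (-β)) ^ (α - 1) := by
    rw [← rpow_mul hx.le, ← rpow_add hx]
    ring_nf
  simp only [smul_eq_mul, abs_neg, abs_of_pos hβ, h]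
  field_simp

open MeasureTheory Set Real in
theorem tendsto_rpow_mul_tsum_rpow_mul_exp {α β : ℝ} (hα : 0 < α) (hβ : 0 < β) :
    Tendsto (fun t : ℝ => t ^ α *
      ∑' k : ℕ, ((k : ℝ) + 1) ^ (-(1 + α * β)) * exp (-t * ((k : ℝ) + 1) ^ (-β)))
      atTop (nhds (Gamma α / β)) := by
  have hs : 1 < 1 + α * β := by linarith [mul_pos hα hβ]
  have hR := tendsto_tsum_riemann_Ioi (f := fun x => x ^ (-(1 + α * β)) * exp (-x ^ (-β)))
    (g := fun x => 2 ^ (1 + α * β) *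
      max 1 (((1 + α * β) / β) ^ ((1 + α * β) / β)) * (x + 1) ^ (-(1 + α * β)))
    (by
      intro x (hx : 0 < x)
      have h (p : ℝ) := continuousAt_rpow_const x p (.inl hx.ne')
      exact ((h _).mul (h _).neg.rexp).continuousWithinAt)
    (by
      intro x (hx : 0 < x) y (hy : 0 < y) hxy
      refine mul_le_mul_of_nonneg_left ?_ (by positivity)
      exact rpow_le_rpow_of_nonpos (by positivity) (by linarith) (by linarith))
    ((integrableOn_add_rpow_Ioi_of_lt (by linarith) (by norm_num)).const_mul _)
    (fun x hx => by
      rw [abs_of_nonneg (by positivity)]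
      exact rpow_neg_mul_exp_neg_rpow_le (by linarith) hβ hx)
  rw [integral_rpow_neg_mul_exp_neg_rpow hα hβ] at hR
  refine (hR.comp (tendsto_rpow_atTop (inv_pos.2 hβ))).congr' ?_
  filter_upwards [eventually_gt_atTop 0] with t ht
  rw [Function.comp_apply, ← tsum_mul_left]
  refine tsum_congr fun k => ?_
  have hk : (0 : ℝ) ≤ (k : ℝ) + 1 := by positivity
  have h1 : (((k : ℝ) + 1) / t ^ β⁻¹) ^ (-β) = t * ((k : ℝ) + 1) ^ (-β) := by
    rw [div_rpow hk (by positivity), ← rpow_mul ht.le,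
      show β⁻¹ * -β = -1 by field_simp, rpow_neg_one, div_inv_eq_mul, mul_comm]
  have h2 : 1 / t ^ β⁻¹ * (((k : ℝ) + 1) / t ^ β⁻¹) ^ (-(1 + α * β)) =
      t ^ α * ((k : ℝ) + 1) ^ (-(1 + α * β)) := by
    rw [div_rpow hk (by positivity), ← rpow_mul ht.le, one_div, ← rpow_neg ht.le,
      div_eq_mul_inv, ← rpow_neg ht.le, mul_left_comm, ← rpow_add ht, mul_comm]
    congr 2
    field_simp
    ring
  rw [h1, ← mul_assoc, h2, mul_assoc, neg_mul]

open Filter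

/-- With `K t = ∑_{k≥1} k^{-(1+αβ)} e^{-t k^{-β}}`, the quantity `t^α K t`
converges to `Γ(α)/β` as `t → ∞`; in particular `K t / t^{-α}` tends to a finite
positive constant. -/
theorem gle_kernel_power_law_decay (α β : ℝ) (hα : 0 < α) (hβ : 0 < β)
    (K : ℝ → ℝ)
    (hK : ∀ t : ℝ, K t =
      ∑' k : ℕ, ((k : ℝ) + 1) ^ (-(1 + α * β)) * Real.exp (-t * ((k : ℝ) + 1) ^ (-β))) :
    Tendsto (fun t : ℝ => t ^ α * K t) atTop (nhds (Real.Gamma α / β)) ∧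
      ∃ c : ℝ, 0 < c ∧
        Tendsto (fun t : ℝ => K t / t ^ (-α)) atTop (nhds c) := by
  have h : Tendsto (fun t : ℝ => t ^ α * K t) atTop (nhds (Real.Gamma α / β)) := by
    simp only [hK]
    exact tendsto_rpow_mul_tsum_rpow_mul_exp hα hβ
  refine ⟨h, Real.Gamma α / β, div_pos (Real.Gamma_pos_of_pos hα) hβ, h.congr' ?_⟩
  filter_upwards [eventually_gt_atTop 0] with t ht
  rw [Real.rpow_neg ht.le, div_inv_eq_mul, mul_comm]
end

section
/- For every real b ≥ 0, ∫_0^b e^{r²/2} (∫_0^r e^{-ℓ²/2} dℓ) dr ≥ e^{b²/4} − 1. -/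
lemma half_mul_exp_le_integral_exp_neg_sq (r : ℝ) (hr : 0 ≤ r) :
    r / 2 * Real.exp (-r ^ 2 / 4) ≤ ∫ ℓ in (0:ℝ)..r, Real.exp (-ℓ ^ 2 / 2) := by
  have hderiv (x : ℝ) : HasDerivAt (fun x : ℝ => x / 2 * Real.exp (-x ^ 2 / 4))
      ((1 / 2 - x ^ 2 / 4) * Real.exp (-x ^ 2 / 4)) x := by
    have h := ((hasDerivAt_id x).div_const 2).mul (((hasDerivAt_pow 2 x).neg.div_const 4).exp)
    refine h.congr_deriv ?_
    simp
    ring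
  have hFTC : ∫ x in (0:ℝ)..r, (1 / 2 - x ^ 2 / 4) * Real.exp (-x ^ 2 / 4) =
      r / 2 * Real.exp (-r ^ 2 / 4) := by
    rw [intervalIntegral.integral_eq_sub_of_hasDerivAt (fun x _ => hderiv x)
      (Continuous.intervalIntegrable (by fun_prop) _ _)]
    simp
  rw [← hFTC]
  refine intervalIntegral.integral_mono_on hr (Continuous.intervalIntegrable (by fun_prop) _ _)
    (Continuous.intervalIntegrable (by fun_prop) _ _) fun x _ => ?_
  have hsplit : Real.exp (-x ^ 2 / 2) = Real.exp (-x ^ 2 / 4) * Real.exp (-x ^ 2 / 4) := by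
    rw [← Real.exp_add]
    ring_nf
  rw [hsplit]
  gcongr
  linarith [Real.add_one_le_exp (-x ^ 2 / 4)]

/-- For every real b ≥ 0,
`∫_0^b e^{r²/2} (∫_0^r e^{-ℓ²/2} dℓ) dr ≥ e^{b²/4} − 1`. -/
theorem iterated_integral_lower_bound (b : ℝ) (hb : 0 ≤ b) :
    Real.exp (b ^ 2 / 4) - 1 ≤
      ∫ r in (0:ℝ)..b, Real.exp (r ^ 2 / 2) * ∫ ℓ in (0:ℝ)..r, Real.exp (-ℓ ^ 2 / 2) := by
  have hderiv (x : ℝ) : HasDerivAt (fun x : ℝ => Real.exp (x ^ 2 / 4))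
      (x / 2 * Real.exp (x ^ 2 / 4)) x := by
    refine (((hasDerivAt_pow 2 x).div_const 4).exp).congr_deriv ?_
    simp
    ring
  have hFTC : ∫ x in (0:ℝ)..b, x / 2 * Real.exp (x ^ 2 / 4) = Real.exp (b ^ 2 / 4) - 1 := by
    rw [intervalIntegral.integral_eq_sub_of_hasDerivAt (fun x _ => hderiv x)
      (Continuous.intervalIntegrable (by fun_prop) _ _)]
    simp
  have hcont : Continuous fun r : ℝ => ∫ ℓ in (0:ℝ)..r, Real.exp (-ℓ ^ 2 / 2) :=
    intervalIntegral.continuous_primitive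
      (fun _ _ => Continuous.intervalIntegrable (by fun_prop) _ _) 0
  rw [← hFTC]
  refine intervalIntegral.integral_mono_on hb (Continuous.intervalIntegrable (by fun_prop) _ _)
    (Continuous.intervalIntegrable (by fun_prop) _ _) fun x hx => ?_
  calc x / 2 * Real.exp (x ^ 2 / 4)
      = Real.exp (x ^ 2 / 2) * (x / 2 * Real.exp (-x ^ 2 / 4)) := by
        rw [mul_left_comm, ← Real.exp_add]
        ring_nf
    _ ≤ _ := by
        gcongr
        exact half_mul_exp_le_integral_exp_neg_sq x hx.1
end

section
/- For every real b ≥ 0, ∫_0^b e^{r²/2} (∫_0^r e^{-ℓ²/2} dℓ) dr ≥ (b²/4) e^{b²/8}. Consequently, for A, η, κ, T > 0, the quantity ηT / ∫_0^{√(ηA/κ)} e^{r²/2} (∫_0^r e^{-ℓ²/2} dℓ) dr is at most (4κT/A) e^{-ηA/(8κ)}. -/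
/-- A primitive vanishing at `0` is bounded by the integral of any majorant of its derivative. -/
lemma le_intervalIntegral_of_hasDerivAt_le {f g g' : ℝ → ℝ} {b : ℝ} (hb : 0 ≤ b)
    (hf : Continuous f) (hg' : Continuous g') (hg : ∀ x, HasDerivAt g (g' x) x) (hg0 : g 0 = 0)
    (hle : ∀ x, 0 ≤ x → g' x ≤ f x) : g b ≤ ∫ x in (0:ℝ)..b, f x := by
  have h := intervalIntegral.integral_eq_sub_of_hasDerivAt (a := 0) (b := b)
    (fun x _ => hg x) (hg'.intervalIntegrable _ _)
  rw [hg0, sub_zero] at h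
  rw [← h]
  exact intervalIntegral.integral_mono_on hb (hg'.intervalIntegrable _ _)
    (hf.intervalIntegrable _ _) fun x hx => hle x hx.1

lemma le_integral_exp_neg_sq_div_two {r : ℝ} (hr : 0 ≤ r) :
    (r / 2 + r ^ 3 / 16) * Real.exp (-(3 * r ^ 2 / 8)) ≤
      ∫ ℓ in (0:ℝ)..r, Real.exp (-ℓ ^ 2 / 2) := by
  refine le_intervalIntegral_of_hasDerivAt_le
    (g := fun x => (x / 2 + x ^ 3 / 16) * Real.exp (-(3 * x ^ 2 / 8)))
    (g' := fun x => (1 / 2 - 3 * x ^ 2 / 16 - 3 * x ^ 4 / 64) * Real.exp (-(3 * x ^ 2 / 8)))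
    hr (by fun_prop) (by fun_prop) (fun x => ?_) (by simp) (fun x _ => ?_)
  · have h₁ : HasDerivAt (fun x : ℝ => x / 2 + x ^ 3 / 16) (1 / 2 + 3 * x ^ 2 / 16) x := by
      simpa using ((hasDerivAt_id x).div_const 2).fun_add ((hasDerivAt_pow 3 x).div_const 16)
    have h₂ : HasDerivAt (fun x : ℝ => -(3 * x ^ 2 / 8)) (-(3 * (2 * x) / 8)) x := by
      simpa using (((hasDerivAt_pow 2 x).const_mul 3).div_const 8).fun_neg
    refine (h₁.fun_mul h₂.exp).congr_deriv ?_
    ring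
  · have h : Real.exp (-x ^ 2 / 2) = Real.exp (-(x ^ 2 / 8)) * Real.exp (-(3 * x ^ 2 / 8)) := by
      rw [← Real.exp_add]
      ring_nf
    rw [h]
    gcongr
    nlinarith [Real.add_one_le_exp (-(x ^ 2 / 8)), sq_nonneg x, sq_nonneg (x ^ 2)]

lemma sq_div_four_mul_exp_le_integral {b : ℝ} (hb : 0 ≤ b) :
    (b ^ 2 / 4) * Real.exp (b ^ 2 / 8) ≤
      ∫ r in (0:ℝ)..b, Real.exp (r ^ 2 / 2) * ∫ ℓ in (0:ℝ)..r, Real.exp (-ℓ ^ 2 / 2) := by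
  have hcont : Continuous fun r : ℝ => ∫ ℓ in (0:ℝ)..r, Real.exp (-ℓ ^ 2 / 2) :=
    intervalIntegral.continuous_primitive
      (fun _ _ => (by fun_prop : Continuous fun ℓ : ℝ => Real.exp (-ℓ ^ 2 / 2)).intervalIntegrable
        _ _) 0
  refine le_intervalIntegral_of_hasDerivAt_le
    (g := fun x => (x ^ 2 / 4) * Real.exp (x ^ 2 / 8))
    (g' := fun x => (x / 2 + x ^ 3 / 16) * Real.exp (x ^ 2 / 8))
    hb (by fun_prop) (by fun_prop) (fun x => ?_) (by simp) (fun x hx => ?_)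
  · have h (c : ℝ) : HasDerivAt (fun x : ℝ => x ^ 2 / c) (2 * x / c) x := by
      simpa using (hasDerivAt_pow 2 x).div_const c
    refine ((h 4).fun_mul (h 8).exp).congr_deriv ?_
    ring
  · have h : Real.exp (x ^ 2 / 8) = Real.exp (x ^ 2 / 2) * Real.exp (-(3 * x ^ 2 / 8)) := by
      rw [← Real.exp_add]
      ring_nf
    rw [h, mul_left_comm]
    gcongr
    exact le_integral_exp_neg_sq_div_two hx

/-- For every real b ≥ 0,
`∫_0^b e^{r²/2} (∫_0^r e^{-ℓ²/2} dℓ) dr ≥ (b²/4) e^{b²/8}`; consequently, for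
A, η, κ, T > 0, `ηT / ∫_0^{√(ηA/κ)} e^{r²/2} (∫_0^r e^{-ℓ²/2} dℓ) dr ≤ (4κT/A) e^{-ηA/(8κ)}`. -/
theorem iterated_integral_lower_bound_exp :
    (∀ b : ℝ, 0 ≤ b →
      (b ^ 2 / 4) * Real.exp (b ^ 2 / 8) ≤
        ∫ r in (0:ℝ)..b, Real.exp (r ^ 2 / 2) * ∫ ℓ in (0:ℝ)..r, Real.exp (-ℓ ^ 2 / 2)) ∧
    (∀ A η κ T : ℝ, 0 < A → 0 < η → 0 < κ → 0 < T →
      η * T /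
          (∫ r in (0:ℝ)..Real.sqrt (η * A / κ),
            Real.exp (r ^ 2 / 2) * ∫ ℓ in (0:ℝ)..r, Real.exp (-ℓ ^ 2 / 2))
        ≤ (4 * κ * T / A) * Real.exp (-η * A / (8 * κ))) := by
  refine ⟨fun b hb => sq_div_four_mul_exp_le_integral hb, fun A η κ T hA hη hκ hT => ?_⟩
  have h := sq_div_four_mul_exp_le_integral (Real.sqrt_nonneg (η * A / κ))
  rw [Real.sq_sqrt (by positivity)] at h
  refine (div_le_div_of_nonneg_left (by positivity) (by positivity) h).trans_eq ?_
  have hexp : -η * A / (8 * κ) = -(η * A / κ / 8) := by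
    field_simp
  rw [hexp, Real.exp_neg]
  field_simp
end
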